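/- Let g : ℕ → ℝ be nonnegative and strictly decreasing, and let T be a tree with n vertices and diameter d (2 ≤ d ≤ n - 1). Then W(T; g) ≤ W(T_{d,n}; g), with equality if and only if T ≅ T_{d,n}. In particular, among all trees with n vertices and diameter d, T_{d,n} is the unique tree maximising the Harary index H(T) = Σ_{{u,v}} 1/d(u,v). -/

import Mathlib

open SimpleGraph Finset

attribute [local instance] Classical.propDecidable

variable {V : Type*}

/-- The eccentricity of a vertex: the maximum distance to any other vertex. -/
noncomputable def ecc [Fintype V] (G : SimpleGraph V) (v : V) : ℕ :=
  Finset.univ.sup fun u => G.dist v u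

/-- The diameter: the maximum eccentricity. -/
noncomputable def graphDiam [Fintype V] (G : SimpleGraph V) : ℕ :=
  Finset.univ.sup fun v => ecc G v

/-- The radius: the minimum eccentricity. -/
noncomputable def graphRad [Fintype V] [Nonempty V] (G : SimpleGraph V) : ℕ :=
  Finset.univ.inf' Finset.univ_nonempty fun v => ecc G v

/-- The Wiener-type index `W(G;g)`: sum of `g (d(u,v))` over unordered pairs of
distinct vertices (here realised as half of the sum over ordered pairs). -/
noncomputable def wiener [Fintype V] (G : SimpleGraph V) (g : ℕ → ℝ) : ℝ :=
  (∑ p ∈ Finset.univ.offDiag, g (G.dist p.1 p.2)) / 2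

/-- Steiner distance of a set `A`: minimum number of edges of a subtree whose
vertex set contains `A` (in a tree, a connected subgraph on `m+1` vertices has `m` edges). -/
noncomputable def steinerDist [Fintype V] (G : SimpleGraph V) (A : Finset V) : ℕ :=
  sInf {m | ∃ S : Finset V, A ⊆ S ∧ (G.induce (S : Set V)).Connected ∧ S.card = m + 1}

/-- The `k`-Steiner Wiener index. -/
noncomputable def steinerWiener [Fintype V] (G : SimpleGraph V) (k : ℕ) : ℕ :=
  ∑ A ∈ Finset.univ.powersetCard k, steinerDist G A

/-- A leaf (pendent vertex): a vertex of degree 1. -/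
def IsLeaf (G : SimpleGraph V) (v : V) : Prop :=
  Nat.card {u : V // G.Adj v u} = 1

/-- A caterpillar: a tree in which deleting all leaves yields a path;
equivalently (for trees) every non-leaf vertex has at most two non-leaf neighbours. -/
def IsCaterpillar (G : SimpleGraph V) : Prop :=
  ∀ v : V, ¬ IsLeaf G v → Nat.card {u : V // G.Adj v u ∧ ¬ IsLeaf G u} ≤ 2

/-- Two graphs have the same eccentric sequence. -/
def sameEccSeq {W : Type*} [Fintype V] [Fintype W]
    (G : SimpleGraph V) (H : SimpleGraph W) : Prop :=
  ∀ k : ℕ, Nat.card {v : V // ecc G v = k} = Nat.card {w : W // ecc H w = k}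

/-- Vertex type of `T_{d,n}`: the path `v_0,…,v_d` plus `n - d - 1` extra leaves. -/
abbrev TdnVert (n d : ℕ) : Type := Fin (d + 1) ⊕ Fin (n - d - 1)

/-- Base relation of `T_{d,n}`: consecutive path vertices are adjacent, and each of
the `n - d - 1` extra leaves is adjacent to the centre vertex `v_{⌈d/2⌉}`. -/
def tdnRel (n d : ℕ) : TdnVert n d → TdnVert n d → Prop
  | Sum.inl a, Sum.inl b => (a : ℕ) + 1 = (b : ℕ)
  | Sum.inr _, Sum.inl a => (a : ℕ) = (d + 1) / 2
  | _, _ => False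

/-- The tree `T_{d,n}` obtained from a path of order `d+1` by attaching `n - d - 1`
pendent edges to a centre vertex of the path. -/
def Tdn (n d : ℕ) : SimpleGraph (TdnVert n d) :=
  SimpleGraph.fromRel (tdnRel n d)

theorem SimpleGraph.Iso.dist_eq {W : Type*} {G : SimpleGraph V} {H : SimpleGraph W}
    (e : G ≃g H) (hG : G.Connected) (u v : V) : H.dist (e u) (e v) = G.dist u v := by
  apply le_antisymm
  · obtain ⟨p, hp⟩ := hG.exists_walk_length_eq_dist u v
    have := SimpleGraph.dist_le (p.map e.toHom)
    rwa [Walk.length_map, hp] at this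
  · obtain ⟨p, hp⟩ := (e.connected_iff.mp hG).exists_walk_length_eq_dist (e u) (e v)
    have := SimpleGraph.dist_le (p.map e.symm.toHom)
    rw [Walk.length_map, hp] at this
    simpa using this

theorem two_mul_wiener [Fintype V] (G : SimpleGraph V) (g : ℕ → ℝ) :
    2 * wiener G g = ∑ u, ∑ v, if u = v then 0 else g (G.dist u v) := by
  rw [wiener, mul_div_cancel₀ _ two_ne_zero, ← Fintype.sum_prod_type']
  simp only [← ite_not (_ = _)]
  rw [← Finset.sum_filter]
  congr 1
  ext ⟨u, v⟩
  simp

theorem wiener_congr {W : Type*} [Fintype V] [Fintype W] {G : SimpleGraph V}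
    {H : SimpleGraph W} (e : G ≃g H) (hG : G.Connected) (g : ℕ → ℝ) :
    wiener G g = wiener H g := by
  refine mul_left_cancel₀ (two_ne_zero (α := ℝ)) ?_
  rw [two_mul_wiener, two_mul_wiener]
  refine Fintype.sum_equiv e.toEquiv _ _ fun u => Fintype.sum_equiv e.toEquiv _ _ fun v => ?_
  have := e.dist_eq hG u v
  simp_all

/-- In a tree, a vertex has at most one neighbour that is closer to a given root. -/
theorem SimpleGraph.IsTree.eq_of_adj_of_dist {G : SimpleGraph V} (hG : G.IsTree) {r x a b : V}
    (ha : G.Adj a x) (hb : G.Adj b x) (hda : G.dist r x = G.dist r a + 1)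
    (hdb : G.dist r x = G.dist r b + 1) : a = b := by
  obtain ⟨p, hp⟩ := hG.connected.exists_walk_length_eq_dist r a
  obtain ⟨q, hq⟩ := hG.connected.exists_walk_length_eq_dist r b
  have h1 := (p.concat ha).isPath_of_length_eq_dist (by simp [hp, hda])
  have h2 := (q.concat hb).isPath_of_length_eq_dist (by simp [hq, hdb])
  have h3 : p.concat ha = q.concat hb :=
    congrArg Subtype.val ((hG.isAcyclic.subsingleton_path r x).elim ⟨_, h1⟩ ⟨_, h2⟩)
  simpa using congrArg Walk.penultimate h3

/-- The distance from a fixed vertex of a tree along a path first decreases, then increases. -/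
theorem SimpleGraph.IsTree.exists_dist_eq_add_dist {G : SimpleGraph V} (hG : G.IsTree)
    {p : ℕ → V} {d : ℕ} (hadj : ∀ i < d, G.Adj (p i) (p (i + 1)))
    (hne : ∀ i, i + 2 ≤ d → p i ≠ p (i + 2)) (x : V) :
    ∃ j ≤ d, ∀ i ≤ d, G.dist x (p i) = G.dist x (p j) + Nat.dist i j := by
  obtain ⟨j, hj, hmin⟩ := Finset.exists_min_image (Finset.range (d + 1))
    (fun i => G.dist x (p i)) ⟨0, by simp⟩
  have hmin : ∀ i ≤ d, G.dist x (p j) ≤ G.dist x (p i) := fun i hi => hmin i (by simp; omega)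
  have hj : j ≤ d := by simp at hj; omega
  have hstep (i : ℕ) (hi : i < d) := hG.dist_eq_dist_add_one_of_adj x (hadj i hi)
  have hpeak (i : ℕ) (hi : i + 2 ≤ d) (h1 : G.dist x (p (i + 1)) = G.dist x (p i) + 1) :
      ¬ G.dist x (p (i + 1)) = G.dist x (p (i + 1 + 1)) + 1 := fun h2 =>
    hne i hi (hG.eq_of_adj_of_dist (hadj i (by omega)) (hadj (i + 1) (by omega)).symm h1 h2)
  have hright (k : ℕ) : j + k + 1 ≤ d →
      G.dist x (p (j + k + 1)) = G.dist x (p (j + k)) + 1 := by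
    induction k with
    | zero =>
      intro hk
      have h1 := hstep j (by omega)
      have h2 := hmin (j + 1) (by omega)
      simp only [add_zero]
      omega
    | succ k ih =>
      intro hk
      have h1 := ih (by omega)
      have h2 := hstep (j + k + 1) (by omega)
      have h3 := hpeak (j + k) (by omega) h1
      rw [← add_assoc]
      omega
  have hleft (k : ℕ) : ∀ i, i + k + 1 = j → G.dist x (p i) = G.dist x (p (i + 1)) + 1 := by
    induction k with
    | zero =>
      intro i hi
      have h1 := hstep i (by omega)
      have h2 := hmin i (by omega)
      have h3 : i + 1 = j := by omega
      rw [← h3] at h2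
      omega
    | succ k ih =>
      intro i hi
      have h1 := ih (i + 1) (by omega)
      have h2 := hstep i (by omega)
      exact h2.resolve_right fun h => hpeak i (by omega) h h1
  refine ⟨j, hj, fun i hi => ?_⟩
  unfold Nat.dist
  rcases le_total j i with h | h
  · obtain ⟨k, rfl⟩ := Nat.exists_eq_add_of_le h
    clear h
    induction k with
    | zero => simp
    | succ k ih =>
      have h1 := ih (by omega)
      have h2 := hright k (by omega)
      rw [← add_assoc]
      omega
  · obtain ⟨k, hk⟩ := Nat.exists_eq_add_of_le h
    clear h
    induction k generalizing i with
    | zero => subst hk; simp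
    | succ k ih =>
      have h1 := ih (i + 1) (by omega) (by omega)
      have h2 := hleft k i (by omega)
      omega

/-- The sum of `g` over the distances from a pendent vertex attached at position `j` of a path
of length `d` to the vertices of that path. -/
noncomputable def pendentSum (g : ℕ → ℝ) (d j : ℕ) : ℝ :=
  ∑ i ∈ Finset.range (d + 1), g (1 + Nat.dist i j)

theorem pendentSum_add (g : ℕ → ℝ) (j k : ℕ) :
    pendentSum g (j + k) j + g 1 =
      ∑ i ∈ Finset.range (j + 1), g (i + 1) + ∑ i ∈ Finset.range (k + 1), g (i + 1) := by
  have hleft : ∑ i ∈ Finset.range j, g (1 + (j - i)) + g 1 =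
      ∑ i ∈ Finset.range (j + 1), g (i + 1) := by
    induction j with
    | zero => simp
    | succ j ih =>
      rw [Finset.sum_range_succ', Finset.sum_range_succ _ (j + 1), ← ih]
      simp only [Nat.add_sub_add_right, Nat.sub_zero]
      rw [add_comm 1 (j + 1)]
      ring
  rw [pendentSum, add_assoc j k 1, Finset.sum_range_add, ← hleft, add_right_comm]
  refine congrArg₂ (· + ·) (congrArg (· + g 1) ?_) ?_
  · refine Finset.sum_congr rfl fun i hi => ?_
    rw [Finset.mem_range] at hi
    congr 1
    unfold Nat.dist
    omega
  · refine Finset.sum_congr rfl fun i _ => ?_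
    congr 1
    unfold Nat.dist
    omega

theorem pendentSum_sub (g : ℕ → ℝ) {d j : ℕ} (hj : j ≤ d) :
    pendentSum g d (d - j) = pendentSum g d j := by
  obtain ⟨k, rfl⟩ := Nat.exists_eq_add_of_le hj
  have h1 := pendentSum_add g j k
  have h2 := pendentSum_add g k j
  rw [add_comm k j] at h2
  rw [Nat.add_sub_cancel_left]
  linarith

theorem pendentSum_lt_succ {g : ℕ → ℝ} (hg : StrictAntiOn g (Set.Ici 1)) {d j : ℕ}
    (hj : j < d / 2) : pendentSum g d j < pendentSum g d (j + 1) := by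
  obtain ⟨k, rfl⟩ := Nat.exists_eq_add_of_le (show j + 1 ≤ d by omega)
  have h1 := pendentSum_add g j (k + 1)
  have h2 := pendentSum_add g (j + 1) k
  rw [show j + (k + 1) = j + 1 + k by omega, Finset.sum_range_succ _ (k + 1)] at h1
  rw [Finset.sum_range_succ _ (j + 1)] at h2
  have h3 : g (k + 1 + 1) < g (j + 1 + 1) := hg (by simp) (by simp) (by omega)
  linarith

theorem pendentSum_lt_half {g : ℕ → ℝ} (hg : StrictAntiOn g (Set.Ici 1)) {d j : ℕ}
    (hj : j < d / 2) : pendentSum g d j < pendentSum g d (d / 2) := by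
  obtain ⟨k, hk⟩ := Nat.exists_eq_add_of_lt hj
  induction k generalizing j with
  | zero =>
    have := pendentSum_lt_succ hg hj
    rwa [← show d / 2 = j + 1 from hk] at this
  | succ k ih => exact (pendentSum_lt_succ hg hj).trans (ih (by omega) (by omega))

/-- A pendent vertex contributes strictly most when it is attached at a centre of the path. -/
theorem pendentSum_lt_center {g : ℕ → ℝ} (hg : StrictAntiOn g (Set.Ici 1)) {d j : ℕ}
    (hj : j ≤ d) (h1 : j ≠ (d + 1) / 2) (h2 : j ≠ d - (d + 1) / 2) :
    pendentSum g d j < pendentSum g d ((d + 1) / 2) := by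
  rw [← pendentSum_sub g (show (d + 1) / 2 ≤ d by omega),
    show d - (d + 1) / 2 = d / 2 by omega]
  rcases lt_or_ge j (d / 2) with h | h
  · exact pendentSum_lt_half hg h
  · rw [← pendentSum_sub g hj]
    exact pendentSum_lt_half hg (by omega)

theorem pendentSum_le_center {g : ℕ → ℝ} (hg : StrictAntiOn g (Set.Ici 1)) {d j : ℕ}
    (hj : j ≤ d) : pendentSum g d j ≤ pendentSum g d ((d + 1) / 2) := by
  by_cases h1 : j = (d + 1) / 2
  · rw [h1]
  by_cases h2 : j = d - (d + 1) / 2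
  · rw [h2, pendentSum_sub g (by omega)]
  exact (pendentSum_lt_center hg hj h1 h2).le

/-- The `Sum.inl` vertices of `G` form a path, in their natural order. -/
def HasSpine {d m : ℕ} (G : SimpleGraph (Fin (d + 1) ⊕ Fin m)) : Prop :=
  ∀ i j : Fin (d + 1), (i : ℕ) + 1 = j → G.Adj (Sum.inl i) (Sum.inl j)

section Spine

variable {d m : ℕ} {G : SimpleGraph (Fin (d + 1) ⊕ Fin m)}

theorem HasSpine.exists_dist_eq (hs : HasSpine G) (hG : G.IsTree) (x : Fin (d + 1) ⊕ Fin m) :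
    ∃ j : Fin (d + 1), ∀ i : Fin (d + 1),
      G.dist x (Sum.inl i) = G.dist x (Sum.inl j) + Nat.dist i j := by
  obtain ⟨j, hj, h⟩ := hG.exists_dist_eq_add_dist (d := d)
    (p := fun i => Sum.inl (Fin.ofNat (d + 1) i))
    (fun i hi => hs _ _ (by
      simp [Fin.ofNat, Nat.mod_eq_of_lt (show i < d + 1 by omega),
        Nat.mod_eq_of_lt (show i + 1 < d + 1 by omega)]))
    (fun i hi h => by
      simp [Fin.ofNat, Nat.mod_eq_of_lt (show i < d + 1 by omega),
        Nat.mod_eq_of_lt (show i + 2 < d + 1 by omega)] at h) x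
  have hof (i : Fin (d + 1)) : Fin.ofNat (d + 1) i = i := by
    ext
    simp [Fin.ofNat, Nat.mod_eq_of_lt i.isLt]
  refine ⟨⟨j, by omega⟩, fun i => ?_⟩
  have h1 := h i (by omega)
  have h2 := hof ⟨j, by omega⟩
  simp only [hof] at h1 h2
  rwa [h2] at h1

theorem HasSpine.dist_inl_inl (hs : HasSpine G) (hG : G.IsTree) (i j : Fin (d + 1)) :
    G.dist (Sum.inl i) (Sum.inl j) = Nat.dist i j := by
  obtain ⟨k, hk⟩ := hs.exists_dist_eq hG (Sum.inl i)
  have h1 := hk i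
  have h2 := hk j
  rw [SimpleGraph.dist_self] at h1
  unfold Nat.dist at *
  omega

theorem HasSpine.dist_inl_of_adj (hs : HasSpine G) (hG : G.IsTree) {w : Fin m}
    {j : Fin (d + 1)} (hw : G.Adj (Sum.inr w) (Sum.inl j)) (i : Fin (d + 1)) :
    G.dist (Sum.inr w) (Sum.inl i) = 1 + Nat.dist i j := by
  obtain ⟨k, hk⟩ := hs.exists_dist_eq hG (Sum.inr w)
  have h1 := hk i
  have h2 := hk j
  have h3 : 0 < G.dist (Sum.inr w) (Sum.inl k) := hG.connected.pos_dist_of_ne (by simp)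
  rw [SimpleGraph.dist_eq_one_iff_adj.mpr hw] at h2
  unfold Nat.dist at *
  omega

theorem sum_fin_dist_eq_pendentSum (g : ℕ → ℝ) (d j : ℕ) :
    ∑ i : Fin (d + 1), g (1 + Nat.dist i j) = pendentSum g d j := by
  rw [pendentSum, Finset.sum_range]

/-- If a vertex off the spine is not adjacent to the spine, then its contribution is smaller than
the maximum by more than the possible gain from its edge to another vertex off the spine. -/
theorem HasSpine.sum_dist_lt_of_not_adj (hs : HasSpine G) (hG : G.IsTree) (hd : 1 ≤ d)
    {g : ℕ → ℝ} (hg : StrictAntiOn g (Set.Ici 1)) {w : Fin m}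
    (hw : ∀ i, ¬ G.Adj (Sum.inr w) (Sum.inl i)) :
    ∑ i, g (G.dist (Sum.inr w) (Sum.inl i)) + (g 1 - g 2) < pendentSum g d ((d + 1) / 2) := by
  obtain ⟨j, hj⟩ := hs.exists_dist_eq hG (Sum.inr w)
  have h2 : 1 < G.dist (Sum.inr w) (Sum.inl j) :=
    hG.connected.one_lt_dist_of_ne_of_not_adj (by simp) (hw j)
  have hlt (i : Fin (d + 1)) : g (G.dist (Sum.inr w) (Sum.inl i)) < g (1 + Nat.dist i j) :=
    hg (by simp) (by simp [hj i]; omega) (by rw [hj i]; omega)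
  obtain ⟨k, hk⟩ : ∃ k : Fin (d + 1), k ≠ j := by
    have : Nontrivial (Fin (d + 1)) := Fin.nontrivial_iff_two_le.mpr (by omega)
    exact exists_ne j
  have hj2 : g (G.dist (Sum.inr w) (Sum.inl j)) ≤ g 2 :=
    hg.antitoneOn (by simp) (by simp; omega) h2
  have hjj : g (1 + Nat.dist (j : ℕ) j) = g 1 := by simp [Nat.dist_self]
  have hsub : g 1 - g 2 < ∑ i : Fin (d + 1),
      (g (1 + Nat.dist i j) - g (G.dist (Sum.inr w) (Sum.inl i))) := by
    rw [← Finset.add_sum_erase _ _ (Finset.mem_univ j), hjj]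
    have : 0 < ∑ i ∈ Finset.univ.erase j,
        (g (1 + Nat.dist i j) - g (G.dist (Sum.inr w) (Sum.inl i))) :=
      Finset.sum_pos (fun i _ => sub_pos.mpr (hlt i)) ⟨k, by simp [hk]⟩
    linarith
  rw [Finset.sum_sub_distrib, sum_fin_dist_eq_pendentSum] at hsub
  have := pendentSum_le_center hg (show (j : ℕ) ≤ d by omega)
  linarith

theorem HasSpine.sum_dist_le (hs : HasSpine G) (hG : G.IsTree) (hd : 1 ≤ d)
    {g : ℕ → ℝ} (hg : StrictAntiOn g (Set.Ici 1)) (w : Fin m) :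
    ∑ i, g (G.dist (Sum.inr w) (Sum.inl i)) +
      (if ∀ i, ¬ G.Adj (Sum.inr w) (Sum.inl i) then g 1 - g 2 else 0) ≤
        pendentSum g d ((d + 1) / 2) := by
  split_ifs with hw
  · exact (hs.sum_dist_lt_of_not_adj hG hd hg hw).le
  · push Not at hw
    obtain ⟨j, hj⟩ := hw
    simp only [hs.dist_inl_of_adj hG hj, sum_fin_dist_eq_pendentSum, add_zero]
    exact pendentSum_le_center hg (by omega)

theorem HasSpine.exists_adj_of_sum_dist_eq (hs : HasSpine G) (hG : G.IsTree) (hd : 1 ≤ d)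
    {g : ℕ → ℝ} (hg : StrictAntiOn g (Set.Ici 1)) {w : Fin m}
    (heq : ∑ i, g (G.dist (Sum.inr w) (Sum.inl i)) +
      (if ∀ i, ¬ G.Adj (Sum.inr w) (Sum.inl i) then g 1 - g 2 else 0) =
        pendentSum g d ((d + 1) / 2)) :
    ∃ j : Fin (d + 1), ((j : ℕ) = (d + 1) / 2 ∨ (j : ℕ) = d - (d + 1) / 2) ∧
      G.Adj (Sum.inr w) (Sum.inl j) := by
  split_ifs at heq with hw
  · exact absurd heq (hs.sum_dist_lt_of_not_adj hG hd hg hw).ne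
  · push Not at hw
    obtain ⟨j, hj⟩ := hw
    refine ⟨j, ?_, hj⟩
    simp only [hs.dist_inl_of_adj hG hj, sum_fin_dist_eq_pendentSum, add_zero] at heq
    by_contra! h
    exact (pendentSum_lt_center hg (by omega) h.1 h.2).ne heq

/-- The edges among the vertices off the spine are at most as many as the vertices off the spine
that are not adjacent to the spine. -/
theorem HasSpine.sum_adj_inr_le (hs : HasSpine G) (hG : G.IsTree) :
    ∑ w : Fin m, ∑ w' : Fin m, (if G.Adj (Sum.inr w) (Sum.inr w') then (1 : ℝ) else 0) ≤
      2 * ∑ w : Fin m, if ∀ i, ¬ G.Adj (Sum.inr w) (Sum.inl i) then (1 : ℝ) else 0 := by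
  set r : Fin (d + 1) ⊕ Fin m := Sum.inl 0
  let par (w w' : Fin m) : Prop := G.Adj (Sum.inr w) (Sum.inr w') ∧
    G.dist r (Sum.inr w) = G.dist r (Sum.inr w') + 1
  have hpar (w : Fin m) : ∑ w', (if par w w' then (1 : ℝ) else 0) ≤
      if ∀ i, ¬ G.Adj (Sum.inr w) (Sum.inl i) then (1 : ℝ) else 0 := by
    rw [Finset.sum_boole]
    split_ifs with hw
    · norm_cast
      refine Finset.card_le_one.mpr fun a ha b hb => ?_
      rw [Finset.mem_filter] at ha hb
      exact Sum.inr_injective (hG.eq_of_adj_of_dist ha.2.1.symm hb.2.1.symm ha.2.2 hb.2.2)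
    · push Not at hw
      obtain ⟨i, hi⟩ := hw
      norm_cast
      rw [Nat.le_zero, Finset.card_eq_zero, Finset.filter_eq_empty_iff]
      intro a _ ha
      have h1 := hs.dist_inl_of_adj hG hi 0
      have h2 := hs.dist_inl_inl hG 0 i
      rw [SimpleGraph.dist_comm] at h1
      have := hG.eq_of_adj_of_dist hi.symm ha.1.symm (by rw [h1, h2, add_comm]) ha.2
      simp at this
  calc _ ≤ ∑ w : Fin m, ∑ w' : Fin m,
        ((if par w w' then (1 : ℝ) else 0) + if par w' w then (1 : ℝ) else 0) := by
        refine Finset.sum_le_sum fun w _ => Finset.sum_le_sum fun w' _ => ?_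
        by_cases h : G.Adj (Sum.inr w) (Sum.inr w')
        · rcases hG.dist_eq_dist_add_one_of_adj r h with h1 | h1
          · rw [if_pos h, if_pos (show par w w' from ⟨h, h1⟩)]
            split_ifs <;> norm_num
          · rw [if_pos h, if_pos (show par w' w from ⟨h.symm, h1⟩)]
            split_ifs <;> norm_num
        · rw [if_neg h]
          positivity
    _ = 2 * ∑ w : Fin m, ∑ w' : Fin m, (if par w w' then (1 : ℝ) else 0) := by
        simp only [Finset.sum_add_distrib]
        rw [Finset.sum_comm (f := fun w w' => if par w' w then (1 : ℝ) else 0)]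
        ring
    _ ≤ _ := by
        gcongr with w
        exact hpar w

theorem HasSpine.eq_of_adj_of_dist_le_two (hs : HasSpine G) (hG : G.IsTree) {w w' : Fin m}
    {j j' : Fin (d + 1)} (hw : G.Adj (Sum.inr w) (Sum.inl j))
    (hw' : G.Adj (Sum.inr w') (Sum.inl j'))
    (h : G.dist (Sum.inr w') (Sum.inr w) ≤ 2) : j = j' := by
  by_contra hne
  have hdist := hs.dist_inl_of_adj hG hw'
  have hpos : (j : ℕ) ≠ j' := fun h => hne (Fin.ext h)
  rcases hG.dist_eq_dist_add_one_of_adj (Sum.inr w') hw with h1 | h1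
  · rw [hdist j] at h1
    unfold Nat.dist at h1
    omega
  · obtain ⟨k, hk, hkd⟩ : ∃ k : Fin (d + 1), G.Adj (Sum.inl k) (Sum.inl j) ∧
        Nat.dist j j' = Nat.dist k j' + 1 := by
      unfold Nat.dist
      rcases lt_or_gt_of_ne hpos with hlt | hlt
      · exact ⟨⟨j + 1, by omega⟩, (hs _ _ rfl).symm, by simp only; omega⟩
      · exact ⟨⟨j - 1, by omega⟩, hs _ _ (by simp only; omega), by simp only; omega⟩
    have := hG.eq_of_adj_of_dist hk hw (by rw [hdist, hdist, hkd, add_assoc]) h1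
    simp at this

/-- Twice the Wiener-type index of the tree obtained from a path of length `d` by attaching `m`
pendent vertices at a centre. -/
noncomputable def twoWienerBound (g : ℕ → ℝ) (d m : ℕ) : ℝ :=
  (∑ i : Fin (d + 1), ∑ j : Fin (d + 1), if i = j then 0 else g (Nat.dist i j)) +
    2 * (∑ _w : Fin m, pendentSum g d ((d + 1) / 2)) +
    ∑ w : Fin m, ∑ w' : Fin m, if w = w' then 0 else g 2

theorem two_mul_wiener_sum (G : SimpleGraph (Fin (d + 1) ⊕ Fin m)) (g : ℕ → ℝ) :
    2 * wiener G g =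
      (∑ i : Fin (d + 1), ∑ j : Fin (d + 1),
        if i = j then 0 else g (G.dist (Sum.inl i) (Sum.inl j))) +
      2 * (∑ w : Fin m, ∑ i : Fin (d + 1), g (G.dist (Sum.inr w) (Sum.inl i))) +
      ∑ w : Fin m, ∑ w' : Fin m, if w = w' then 0 else g (G.dist (Sum.inr w) (Sum.inr w')) := by
  rw [two_mul_wiener]
  simp only [Fintype.sum_sum_type, Sum.inl.injEq, Sum.inr.injEq, reduceCtorEq, if_false,
    Finset.sum_add_distrib]
  rw [Finset.sum_comm (f := fun (i : Fin (d + 1)) (w : Fin m) =>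
    g (G.dist (Sum.inl i) (Sum.inr w)))]
  simp only [SimpleGraph.dist_comm (u := Sum.inl _) (v := Sum.inr _)]
  ring

theorem inr_term_le (hG : G.IsTree) {g : ℕ → ℝ} (hg : StrictAntiOn g (Set.Ici 1))
    (w w' : Fin m) :
    (if w = w' then 0 else g (G.dist (Sum.inr w) (Sum.inr w'))) ≤
      (if w = w' then 0 else g 2) +
        (g 1 - g 2) * (if G.Adj (Sum.inr w) (Sum.inr w') then (1 : ℝ) else 0) := by
  by_cases h : w = w'
  · subst h
    simp
  by_cases hadj : G.Adj (Sum.inr w) (Sum.inr w')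
  · simp [h, hadj, SimpleGraph.dist_eq_one_iff_adj.mpr hadj]
  · have h2 := hG.connected.one_lt_dist_of_ne_of_not_adj (by simpa using h) hadj
    simp only [h, hadj, if_false, mul_zero, add_zero]
    exact hg.antitoneOn (by simp) (by simp; omega) h2

theorem dist_le_two_of_inr_term_eq {g : ℕ → ℝ}
    (hg : StrictAntiOn g (Set.Ici 1)) {w w' : Fin m}
    (heq : (if w = w' then 0 else g (G.dist (Sum.inr w) (Sum.inr w'))) =
      (if w = w' then 0 else g 2) +
        (g 1 - g 2) * (if G.Adj (Sum.inr w) (Sum.inr w') then (1 : ℝ) else 0)) :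
    G.dist (Sum.inr w) (Sum.inr w') ≤ 2 := by
  by_contra! h
  have hne : w ≠ w' := by
    rintro rfl
    simp at h
  have hadj : ¬ G.Adj (Sum.inr w) (Sum.inr w') := fun hadj => by
    rw [SimpleGraph.dist_eq_one_iff_adj.mpr hadj] at h
    omega
  simp only [hne, hadj, if_false, mul_zero, add_zero] at heq
  exact (hg (by simp) (by simp; omega) h).ne heq

theorem HasSpine.two_mul_wiener_eq (hs : HasSpine G) (hG : G.IsTree) {g : ℕ → ℝ} :
    2 * wiener G g =
      (∑ i : Fin (d + 1), ∑ j : Fin (d + 1), if i = j then 0 else g (Nat.dist i j)) +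
      2 * (∑ w : Fin m, ∑ i : Fin (d + 1), g (G.dist (Sum.inr w) (Sum.inl i))) +
      ∑ w : Fin m, ∑ w' : Fin m, if w = w' then 0 else g (G.dist (Sum.inr w) (Sum.inr w')) := by
  simp only [two_mul_wiener_sum, hs.dist_inl_inl hG]

theorem HasSpine.two_mul_wiener_le (hs : HasSpine G) (hG : G.IsTree) (hd : 1 ≤ d)
    {g : ℕ → ℝ} (hg : StrictAntiOn g (Set.Ici 1)) :
    2 * wiener G g ≤ twoWienerBound g d m ∧
      (2 * wiener G g = twoWienerBound g d m →
        ∃ j : Fin (d + 1), ((j : ℕ) = (d + 1) / 2 ∨ (j : ℕ) = d - (d + 1) / 2) ∧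
          ∀ w, G.Adj (Sum.inr w) (Sum.inl j)) := by
  have hterm (w : Fin m) := Finset.sum_le_sum fun w' (_ : w' ∈ Finset.univ) =>
    inr_term_le hG hg w w'
  have hinr := Finset.sum_le_sum fun w (_ : w ∈ Finset.univ) => hterm w
  have hinl := Finset.sum_le_sum fun w (_ : w ∈ Finset.univ) => hs.sum_dist_le hG hd hg w
  have hcount := mul_le_mul_of_nonneg_left (hs.sum_adj_inr_le hG)
    (sub_nonneg.mpr (hg.antitoneOn (by simp) (by simp) one_le_two : g 2 ≤ g 1))
  have hinr' := hinr
  have hinl' := hinl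
  simp only [Finset.sum_add_distrib, ← Finset.mul_sum] at hinr'
  simp only [Finset.sum_add_distrib, ← mul_boole _ (g 1 - g 2), ← Finset.mul_sum] at hinl'
  have hW := hs.two_mul_wiener_eq hG (g := g)
  unfold twoWienerBound
  refine ⟨by linarith, fun heq => ?_⟩
  have hinl_eq := (Finset.sum_eq_sum_iff_of_le fun w _ => hs.sum_dist_le hG hd hg w).mp <| by
    refine le_antisymm hinl ?_
    simp only [Finset.sum_add_distrib, ← mul_boole _ (g 1 - g 2), ← Finset.mul_sum]
    linarith
  have hinr_eq := (Finset.sum_eq_sum_iff_of_le fun w _ => hterm w).mp <| by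
    refine le_antisymm hinr ?_
    simp only [Finset.sum_add_distrib, ← Finset.mul_sum]
    linarith
  have hatt (w : Fin m) := hs.exists_adj_of_sum_dist_eq hG hd hg (hinl_eq w (Finset.mem_univ w))
  rcases isEmpty_or_nonempty (Fin m) with hm | ⟨⟨w₀⟩⟩
  · exact ⟨⟨(d + 1) / 2, by omega⟩, Or.inl rfl, fun w => isEmptyElim w⟩
  · obtain ⟨j, hj, hadj⟩ := hatt w₀
    refine ⟨j, hj, fun w => ?_⟩
    obtain ⟨j', -, hadj'⟩ := hatt w
    have := (Finset.sum_eq_sum_iff_of_le fun w' _ => inr_term_le hG hg w₀ w').mp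
      (hinr_eq w₀ (Finset.mem_univ w₀)) w (Finset.mem_univ w)
    rwa [← hs.eq_of_adj_of_dist_le_two hG hadj' hadj (dist_le_two_of_inr_term_eq hg this)]

end Spine

section Tdn

variable (n d : ℕ)

theorem hasSpine_tdn : HasSpine (Tdn n d) := fun i j h => by
  refine (SimpleGraph.fromRel_adj _ _ _).mpr ⟨?_, Or.inl h⟩
  intro h'
  rw [Sum.inl.inj h'] at h
  omega

theorem tdn_adj_inr_inl (w : Fin (n - d - 1)) {j : Fin (d + 1)} (hj : (j : ℕ) = (d + 1) / 2) :
    (Tdn n d).Adj (Sum.inr w) (Sum.inl j) :=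
  (SimpleGraph.fromRel_adj _ _ _).mpr ⟨by simp, Or.inl hj⟩

variable {n d}

theorem tdn_le {G : SimpleGraph (TdnVert n d)} (hs : HasSpine G)
    (hG : ∀ w, ∀ j : Fin (d + 1), (j : ℕ) = (d + 1) / 2 → G.Adj (Sum.inr w) (Sum.inl j)) :
    Tdn n d ≤ G := by
  have key : ∀ x y, tdnRel n d x y → G.Adj x y := by
    rintro (a | w) (b | w') h
    · exact hs a b h
    · exact h.elim
    · exact hG w b h
    · exact h.elim
  intro x y hxy
  rcases ((SimpleGraph.fromRel_adj _ _ _).mp hxy).2 with h | h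
  · exact key x y h
  · exact (key y x h).symm

theorem HasSpine.exists_walk_length {m : ℕ} {G : SimpleGraph (Fin (d + 1) ⊕ Fin m)}
    (hs : HasSpine G) (k : ℕ) :
    ∀ i j : Fin (d + 1), (i : ℕ) + k = j →
      ∃ p : G.Walk (Sum.inl i) (Sum.inl j), p.length = k := by
  induction k with
  | zero =>
    intro i j h
    obtain rfl : i = j := Fin.ext h
    exact ⟨Walk.nil, rfl⟩
  | succ k ih =>
    intro i j h
    obtain ⟨p, hp⟩ := ih ⟨i + 1, by omega⟩ j (by simp only; omega)
    exact ⟨Walk.cons (hs _ _ rfl) p, by simp [hp]⟩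

theorem HasSpine.exists_walk_length_dist {m : ℕ} {G : SimpleGraph (Fin (d + 1) ⊕ Fin m)}
    (hs : HasSpine G) (i j : Fin (d + 1)) :
    ∃ p : G.Walk (Sum.inl i) (Sum.inl j), p.length = Nat.dist i j := by
  rcases le_total (i : ℕ) j with h | h
  · exact hs.exists_walk_length _ i j (by unfold Nat.dist; omega)
  · obtain ⟨p, hp⟩ := hs.exists_walk_length (Nat.dist i j) j i (by unfold Nat.dist; omega)
    exact ⟨p.reverse, by simp [hp]⟩

theorem tdn_connected : (Tdn n d).Connected := by
  have hc : (d + 1) / 2 < d + 1 := by omega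
  have h (x) : (Tdn n d).Reachable x (Sum.inl ⟨(d + 1) / 2, hc⟩) := by
    rcases x with i | w
    · obtain ⟨p, -⟩ := (hasSpine_tdn n d).exists_walk_length_dist i ⟨(d + 1) / 2, hc⟩
      exact p.reachable
    · exact (tdn_adj_inr_inl n d w rfl).reachable
  exact ⟨fun x y => (h x).trans (h y).symm⟩

theorem twoWienerBound_le_tdn {g : ℕ → ℝ} (hg : StrictAntiOn g (Set.Ici 1)) :
    twoWienerBound g d (n - d - 1) ≤ 2 * wiener (Tdn n d) g := by
  have hc : (d + 1) / 2 < d + 1 := by omega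
  have hdist (i j : Fin (d + 1)) : (Tdn n d).dist (Sum.inl i) (Sum.inl j) ≤ Nat.dist i j := by
    obtain ⟨p, hp⟩ := (hasSpine_tdn n d).exists_walk_length_dist i j
    exact hp ▸ SimpleGraph.dist_le p
  have hanti {x y} {k : ℕ} (hxy : x ≠ y) (h : (Tdn n d).dist x y ≤ k) :
      g k ≤ g ((Tdn n d).dist x y) := by
    have := (tdn_connected (n := n) (d := d)).pos_dist_of_ne hxy
    exact hg.antitoneOn (by simp; omega) (by simp; omega) h
  have hone (w : Fin (n - d - 1)) :
      (Tdn n d).dist (Sum.inr w) (Sum.inl ⟨(d + 1) / 2, hc⟩) = 1 :=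
    SimpleGraph.dist_eq_one_iff_adj.mpr (tdn_adj_inr_inl n d w rfl)
  rw [two_mul_wiener_sum, twoWienerBound]
  gcongr with i _ j _ w _ w _ w' _
  · split_ifs with h
    · rfl
    · exact hanti (by simpa using h) (hdist i j)
  · rw [← sum_fin_dist_eq_pendentSum]
    gcongr with i
    refine hanti (by simp) ?_
    refine (tdn_connected.dist_triangle (v := Sum.inl ⟨(d + 1) / 2, hc⟩)).trans ?_
    rw [hone, Nat.dist_comm]
    exact Nat.add_le_add_left (hdist _ _) 1
  · split_ifs with h
    · rfl
    · refine hanti (by simpa using h) ?_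
      refine (tdn_connected.dist_triangle (v := Sum.inl ⟨(d + 1) / 2, hc⟩)).trans ?_
      rw [hone, SimpleGraph.dist_comm, hone]

theorem HasSpine.nonempty_iso_tdn {G : SimpleGraph (TdnVert n d)} (hs : HasSpine G)
    (hG : G.IsTree) {j : Fin (d + 1)}
    (hj : (j : ℕ) = (d + 1) / 2 ∨ (j : ℕ) = d - (d + 1) / 2)
    (hadj : ∀ w, G.Adj (Sum.inr w) (Sum.inl j)) : Nonempty (G ≃g Tdn n d) := by
  have hle_eq {H : SimpleGraph (TdnVert n d)} (hH : H.IsTree) (hle : Tdn n d ≤ H) :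
      H = Tdn n d :=
    le_antisymm ((SimpleGraph.isTree_iff_minimal_connected.mp hH).2 tdn_connected hle) hle
  rcases hj with hj | hj
  · have := hle_eq hG <| tdn_le hs fun w i hi => by
      obtain rfl : i = j := Fin.ext (hi.trans hj.symm)
      exact hadj w
    exact ⟨this ▸ SimpleGraph.Iso.refl⟩
  · let e : TdnVert n d ≃ TdnVert n d := Equiv.sumCongr Fin.revPerm (Equiv.refl _)
    let f : G.comap e ≃g G := SimpleGraph.Iso.comap e G
    have := hle_eq (f.isTree_iff.mpr hG) <| tdn_le
      (fun i k h => (hs k.rev i.rev (by simp only [Fin.val_rev]; omega)).symm)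
      fun w i hi => by
        obtain rfl : i.rev = j := Fin.ext (by simp only [Fin.val_rev]; omega)
        exact hadj w
    exact ⟨this ▸ f.symm⟩

end Tdn

theorem exists_dist_eq_graphDiam [Fintype V] [Nonempty V] (G : SimpleGraph V) :
    ∃ u v, G.dist u v = graphDiam G := by
  obtain ⟨u, -, hu⟩ := Finset.exists_mem_eq_sup _ (Finset.univ_nonempty (α := V)) (ecc G)
  obtain ⟨v, -, hv⟩ := Finset.exists_mem_eq_sup _ (Finset.univ_nonempty (α := V)) (G.dist u)
  exact ⟨u, v, (hu.trans hv).symm⟩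

/-- A diametral path of a connected graph identifies it with a graph having a spine. -/
theorem SimpleGraph.Connected.exists_iso_hasSpine [Fintype V] {G : SimpleGraph V}
    (hG : G.Connected) :
    ∃ H : SimpleGraph (TdnVert (Fintype.card V) (graphDiam G)),
      Nonempty (H ≃g G) ∧ HasSpine H := by
  have := hG.nonempty
  obtain ⟨u, v, huv⟩ := exists_dist_eq_graphDiam G
  obtain ⟨q, hq, hlen⟩ := hG.exists_path_of_dist u v
  rw [huv] at hlen
  generalize graphDiam G = d at *
  let p : Fin (d + 1) → V := fun i => q.getVert i
  have hp : Function.Injective p := fun i j h =>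
    Fin.ext (hq.getVert_injOn (by simp; omega) (by simp; omega) h)
  have hcard : Fintype.card {x // x ∉ Set.range p} = Fintype.card V - d - 1 := by
    rw [Fintype.card_subtype_compl, ← Fintype.card_congr (Equiv.ofInjective p hp),
      Fintype.card_fin, Nat.sub_sub]
  let e : TdnVert (Fintype.card V) d ≃ V :=
    ((Equiv.ofInjective p hp).sumCongr (Fintype.equivFinOfCardEq hcard).symm).trans
      (Equiv.sumCompl (· ∈ Set.range p))
  refine ⟨G.comap e, ⟨SimpleGraph.Iso.comap e G⟩, fun i j h => ?_⟩
  change G.Adj (p i) (p j)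
  simp only [p, ← h]
  exact q.adj_getVert_succ (by omega)

theorem wiener_le_tdn_and_eq_iff [Fintype V] {g : ℕ → ℝ} (hg : StrictAntiOn g (Set.Ici 1))
    {G : SimpleGraph V} (hG : G.IsTree) (hd : 1 ≤ graphDiam G) :
    wiener G g ≤ wiener (Tdn (Fintype.card V) (graphDiam G)) g ∧
      (wiener G g = wiener (Tdn (Fintype.card V) (graphDiam G)) g ↔
        Nonempty (G ≃g Tdn (Fintype.card V) (graphDiam G))) := by
  obtain ⟨H, ⟨f⟩, hs⟩ := hG.connected.exists_iso_hasSpine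
  have hH := f.isTree_iff.mpr hG
  obtain ⟨hle, heq⟩ := hs.two_mul_wiener_le hH hd hg
  rw [wiener_congr f hH.connected] at hle heq
  have hT := twoWienerBound_le_tdn (n := Fintype.card V) (d := graphDiam G) hg
  refine ⟨by linarith, fun h => ?_, fun ⟨f'⟩ => wiener_congr f' hG.connected g⟩
  obtain ⟨j, hj, hadj⟩ := heq (by linarith)
  obtain ⟨f'⟩ := hs.nonempty_iso_tdn hH hj hadj
  exact ⟨f.symm.trans f'⟩

/-- For nonnegative strictly decreasing `g` and any tree `T` with `n` vertices and
diameter `d` (`2 ≤ d ≤ n-1`): `W(T;g) ≤ W(T_{d,n};g)`, with equality iff `T ≅ T_{d,n}`.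
In particular `T_{d,n}` is the unique maximiser of the Harary index
`H(T) = Σ_{{u,v}} 1/d(u,v)`. -/
theorem stmt19 [Fintype V] (g : ℕ → ℝ) (hg0 : ∀ k : ℕ, 0 ≤ g k) (hg : StrictAnti g)
    (n d : ℕ) (hd2 : 2 ≤ d) (hdn : d ≤ n - 1)
    (G : SimpleGraph V) (hG : G.IsTree)
    (hcard : Fintype.card V = n) (hdiam : graphDiam G = d) :
    (wiener G g ≤ wiener (Tdn n d) g ∧
      (wiener G g = wiener (Tdn n d) g ↔ Nonempty (G ≃g Tdn n d))) ∧
    (wiener G (fun k => (k : ℝ)⁻¹) ≤ wiener (Tdn n d) (fun k => (k : ℝ)⁻¹) ∧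
      (wiener G (fun k => (k : ℝ)⁻¹) = wiener (Tdn n d) (fun k => (k : ℝ)⁻¹) ↔
        Nonempty (G ≃g Tdn n d))) := by
  subst hcard hdiam
  refine ⟨wiener_le_tdn_and_eq_iff (hg.strictAntiOn _) hG (by omega),
    wiener_le_tdn_and_eq_iff (fun a ha b _ hab => ?_) hG (by omega)⟩
  have ha : 0 < a := ha
  exact inv_strictAnti₀ (by exact_mod_cast ha) (by exact_mod_cast hab)
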